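/- Let n ≥ 2 be an integer and let p and q be real polynomials of degree at most n−2, not both identically zero. Then the function g(h) = p(h) Ī₂(h) + q(h) Ī₀(h) has at most 2n−3 zeros in the interval (−1,0). -/

import Mathlib

open intervalIntegral Real

/-- `Ī_k(h) = ∫_{u₁(h)}^{u₂(h)} u^k √(h + 2u² − u⁴) du` where
`u₁(h) = √(1 − √(1+h))` and `u₂(h) = √(1 + √(1+h))`. -/
noncomputable def Ibar (k : ℕ) (h : ℝ) : ℝ :=
  ∫ u in (Real.sqrt (1 - Real.sqrt (1 + h)))..(Real.sqrt (1 + Real.sqrt (1 + h))),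
    u ^ k * Real.sqrt (h + 2 * u ^ 2 - u ^ 4)

/-- The weights of the Gauss continued fraction of
`₂F₁(5/4, 3/4; 3; z) / ₂F₁(1/4, 3/4; 2; z)`. -/
noncomputable def gaussWeight (i : ℕ) : ℝ :=
  (2 * i + 3) * (2 * i + 7) / (16 * (i + 2) * (i + 3))

lemma gaussWeight_pos (i : ℕ) : 0 < gaussWeight i := by
  unfold gaussWeight; positivity

/-- Weighted counts of nonnegative lattice paths of length `m` ending at height `i`, where a down
step from height `j + 1` to height `j` has weight `k j`. -/
def pathSum (k : ℕ → ℝ) : ℕ → ℕ → ℝ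
  | 0, 0 => 1
  | _ + 1, 0 => 0
  | 0, m + 1 => k 0 * pathSum k 1 m
  | i + 1, m + 1 => pathSum k i m + k (i + 1) * pathSum k (i + 2) m

section PathSum

variable (k : ℕ → ℝ)

lemma pathSum_eq_zero {i m : ℕ} (h : m < i) : pathSum k i m = 0 := by
  induction m generalizing i with
  | zero => obtain ⟨i, rfl⟩ := Nat.exists_eq_add_of_lt h; simp [pathSum]
  | succ m ih =>
    obtain ⟨i, rfl⟩ : ∃ j, i = j + 1 := ⟨i - 1, by omega⟩
    simp [pathSum, ih (show m < i by omega), ih (show m < i + 2 by omega)]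

lemma pathSum_self (i : ℕ) : pathSum k i i = 1 := by
  induction i with
  | zero => simp [pathSum]
  | succ i ih => simp [pathSum, ih, pathSum_eq_zero k (show i < i + 2 by omega)]

lemma pathSum_nonneg (hk : ∀ i, 0 < k i) (i m : ℕ) : 0 ≤ pathSum k i m := by
  induction m generalizing i with
  | zero => cases i <;> simp [pathSum]
  | succ m ih =>
    cases i with
    | zero => exact mul_nonneg (hk _).le (ih _)
    | succ i => exact add_nonneg (ih _) (mul_nonneg (hk _).le (ih _))

/-- The pairing of two columns of path counts moves steps across. -/
lemma sum_pathSum_succ_mul (M a b : ℕ) (ha : a < M) :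
    ∑ i ∈ Finset.range (M + 1),
        (∏ j ∈ Finset.range i, k j) * (pathSum k i (a + 1) * pathSum k i b) =
      ∑ i ∈ Finset.range M, (∏ j ∈ Finset.range (i + 1), k j) *
        (pathSum k i a * pathSum k (i + 1) b + pathSum k (i + 1) a * pathSum k i b) := by
  have h1 : ∀ i, (∏ j ∈ Finset.range (i + 1), k j) * (pathSum k (i + 1) (a + 1) *
      pathSum k (i + 1) b) = (∏ j ∈ Finset.range (i + 1), k j) *
        (pathSum k i a * pathSum k (i + 1) b) + (∏ j ∈ Finset.range (i + 2), k j) *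
        (pathSum k (i + 2) a * pathSum k (i + 1) b) := fun i => by
    rw [Finset.prod_range_succ _ (i + 1), pathSum]; ring
  have h2 := Finset.sum_range_succ' (fun i => (∏ j ∈ Finset.range (i + 1), k j) *
    (pathSum k (i + 1) a * pathSum k i b)) M
  rw [Finset.sum_range_succ] at h2
  rw [Finset.sum_range_succ', Finset.sum_congr rfl fun i _ => h1 i]
  simp only [mul_add, Finset.sum_add_distrib]
  rw [pathSum_eq_zero k (show a < M + 1 by omega)] at h2
  simp only [pathSum, Finset.prod_range_succ, Finset.prod_range_zero] at h2 ⊢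
  linarith

lemma pathSum_zero_add (M a b : ℕ) (h : a + b < M) :
    pathSum k 0 (a + b) = ∑ i ∈ Finset.range (M + 1),
      (∏ j ∈ Finset.range i, k j) * (pathSum k i a * pathSum k i b) := by
  induction a generalizing b with
  | zero =>
    rw [Finset.sum_range_succ', Finset.sum_eq_zero]
    · simp [pathSum]
    · intro i _; simp [pathSum]
  | succ a ih =>
    rw [show a + 1 + b = a + (b + 1) by ring, ih (b + 1) (by omega),
      sum_pathSum_succ_mul k M a b (by omega),
      Finset.sum_congr rfl fun i _ => by rw [mul_comm (pathSum k i a)],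
      sum_pathSum_succ_mul k M b a (by omega)]
    exact Finset.sum_congr rfl fun i _ => by ring

/-- The Hankel forms of the moments `pathSum k 0` are positive definite. -/
lemma pathSum_hankel_pos (hk : ∀ i, 0 < k i) {N : ℕ} (e : ℕ → ℕ) (c : ℕ → ℝ)
    (he : ∀ a < N, ∀ b < N, a < b → e b < e a) {a₀ : ℕ} (ha₀ : a₀ < N) (hc : c a₀ ≠ 0) :
    0 < ∑ a ∈ Finset.range N, ∑ b ∈ Finset.range N, c a * c b * pathSum k 0 (e a + e b) := by
  classical
  set M := ∑ a ∈ Finset.range N, e a + ∑ a ∈ Finset.range N, e a + 1 with hM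
  have hle : ∀ a ∈ Finset.range N, e a ≤ ∑ a ∈ Finset.range N, e a := fun a ha =>
    Finset.single_le_sum (f := e) (fun _ _ => Nat.zero_le _) ha
  have key : ∑ a ∈ Finset.range N, ∑ b ∈ Finset.range N, c a * c b * pathSum k 0 (e a + e b) =
      ∑ i ∈ Finset.range (M + 1), (∏ j ∈ Finset.range i, k j) *
        (∑ a ∈ Finset.range N, c a * pathSum k i (e a)) ^ 2 := by
    have : ∀ a ∈ Finset.range N, ∀ b ∈ Finset.range N, c a * c b * pathSum k 0 (e a + e b) =
        ∑ i ∈ Finset.range (M + 1), (∏ j ∈ Finset.range i, k j) *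
          (c a * pathSum k i (e a) * (c b * pathSum k i (e b))) := fun a ha b hb => by
      rw [pathSum_zero_add k M _ _ (by have := hle a ha; have := hle b hb; omega),
        Finset.mul_sum]
      exact Finset.sum_congr rfl fun i _ => by ring
    rw [Finset.sum_congr rfl fun a ha => Finset.sum_congr rfl fun b hb => this a ha b hb,
      Finset.sum_congr rfl fun a _ => Finset.sum_comm, Finset.sum_comm]
    refine Finset.sum_congr rfl fun i _ => ?_
    rw [sq, Finset.sum_mul_sum, Finset.mul_sum]
    exact Finset.sum_congr rfl fun a _ => by rw [Finset.mul_sum]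
  rw [key]
  have hex : ∃ a, a < N ∧ c a ≠ 0 := ⟨a₀, ha₀, hc⟩
  set a := Nat.find hex
  obtain ⟨haN, hca⟩ := Nat.find_spec hex
  refine Finset.sum_pos' (fun i _ => mul_nonneg (Finset.prod_nonneg fun j _ => (hk j).le)
    (sq_nonneg _)) ⟨e a, ?_, ?_⟩
  · have := hle a (Finset.mem_range.2 haN); simp; omega
  · rw [Finset.sum_eq_single a]
    · rw [pathSum_self, mul_one]
      exact mul_pos (Finset.prod_pos fun j _ => hk j) (by positivity)
    · intro b hb hba
      rcases lt_or_gt_of_ne hba with h | h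
      · have := Nat.find_min hex h
        simp only [Finset.mem_range] at hb
        rw [not_and_not_right.1 this hb, zero_mul]
      · rw [pathSum_eq_zero k (he a haN b (Finset.mem_range.1 hb) h), mul_zero]
    · intro h; exact absurd (Finset.mem_range.2 haN) h

end PathSum

/-- Taylor coefficients of `₂F₁((2i+1)/4, (2i+3)/4; i+2; z)`. -/
noncomputable def hyperCoeff (i : ℕ) : ℕ → ℝ
  | 0 => 1
  | n + 1 => hyperCoeff i n * (((2 * i + 1) / 4 + n) * ((2 * i + 3) / 4 + n) /
      ((i + 2 + n) * (n + 1)))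

lemma hyperCoeff_pos (i n : ℕ) : 0 < hyperCoeff i n := by
  induction n with
  | zero => simp [hyperCoeff]
  | succ n ih => rw [hyperCoeff]; positivity

lemma hyperCoeff_le_one {i : ℕ} (hi : i ≤ 1) (n : ℕ) : hyperCoeff i n ≤ 1 := by
  induction n with
  | zero => simp [hyperCoeff]
  | succ n ih =>
    rw [hyperCoeff]
    refine mul_le_one₀ ih (by positivity) ?_
    rw [div_le_one (by positivity)]
    interval_cases i <;> push_cast <;> nlinarith

lemma hyperCoeff_succ_left (i n : ℕ) :
    hyperCoeff (i + 1) n = hyperCoeff i n * (((2 * i + 1) / 4 + n) * (i + 2) /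
      ((2 * i + 1) / 4 * (i + 2 + n))) := by
  induction n with
  | zero => simp [hyperCoeff]; field_simp
  | succ n ih =>
    rw [hyperCoeff, ih, hyperCoeff]
    push_cast
    field_simp
    ring

/-- Gauss's contiguous relation. -/
lemma hyperCoeff_contiguous (i n : ℕ) :
    hyperCoeff (i + 1) (n + 1) = hyperCoeff i (n + 1) + gaussWeight i * hyperCoeff (i + 2) n := by
  rw [hyperCoeff_succ_left i (n + 1), hyperCoeff_succ_left (i + 1) n, hyperCoeff_succ_left i n,
    hyperCoeff, gaussWeight]
  push_cast
  field_simp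
  ring

open PowerSeries in
lemma pathSum_mul_hyperCoeff (i : ℕ) :
    (PowerSeries.mk fun n => pathSum gaussWeight i (i + 2 * n)) * PowerSeries.mk (hyperCoeff 0) =
      PowerSeries.mk (hyperCoeff (i + 1)) := by
  set Θ : ℕ → ℝ⟦X⟧ := fun i => PowerSeries.mk fun n => pathSum gaussWeight i (i + 2 * n) with hΘ
  set Γ : ℕ → ℝ⟦X⟧ := fun i => PowerSeries.mk (hyperCoeff i) with hΓ
  have hΘ0 : Θ 0 = 1 + X * (C (gaussWeight 0) * Θ 1) := by
    ext n
    cases n with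
    | zero => simp [hΘ, pathSum]
    | succ n =>
      simp only [hΘ, map_add, coeff_succ_X_mul, coeff_C_mul, coeff_mk, coeff_one]
      rw [show 0 + 2 * (n + 1) = (1 + 2 * n) + 1 by ring, pathSum]
      simp
  have hΘs : ∀ i, Θ (i + 1) = Θ i + X * (C (gaussWeight (i + 1)) * Θ (i + 2)) := fun i => by
    ext n
    cases n with
    | zero => simp [hΘ, pathSum_self]
    | succ n =>
      simp only [hΘ, map_add, coeff_succ_X_mul, coeff_C_mul, coeff_mk]
      rw [show i + 1 + 2 * (n + 1) = (i + 2 + 2 * n) + 1 by ring, pathSum]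
      congr 2; ring
  have hΓs : ∀ i, Γ (i + 1) = Γ i + X * (C (gaussWeight i) * Γ (i + 2)) := fun i => by
    ext n
    cases n with
    | zero => simp [hΓ, hyperCoeff]
    | succ n =>
      simp only [hΓ, map_add, coeff_succ_X_mul, coeff_C_mul, coeff_mk]
      exact hyperCoeff_contiguous i n
  have hE0 : Θ 0 * Γ 0 - Γ 1 = X * (C (gaussWeight 0) * (Θ 1 * Γ 0 - Γ 2)) := by
    rw [hΓs 0, hΘ0]; ring
  have hEs : ∀ i, Θ (i + 1) * Γ 0 - Γ (i + 2) = (Θ i * Γ 0 - Γ (i + 1)) +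
      X * (C (gaussWeight (i + 1)) * (Θ (i + 2) * Γ 0 - Γ (i + 3))) := fun i => by
    rw [hΓs (i + 1), hΘs]; ring
  have key : ∀ n i, coeff n (Θ i * Γ 0 - Γ (i + 1)) = 0 := by
    intro n
    induction n with
    | zero =>
      intro i
      induction i with
      | zero => rw [hE0]; simp
      | succ i ih => rw [hEs, map_add, ih]; simp
    | succ n ihn =>
      intro i
      induction i with
      | zero => rw [hE0, coeff_succ_X_mul, coeff_C_mul, ihn 1, mul_zero]
      | succ i ih => rw [hEs, map_add, ih, coeff_succ_X_mul, coeff_C_mul, ihn (i + 2)]; simp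
  exact sub_eq_zero.1 (PowerSeries.ext fun n => (key n i).trans (map_zero _).symm)

/-- The Taylor coefficients of `₂F₁(5/4, 3/4; 3; z) / ₂F₁(1/4, 3/4; 2; z)`. -/
noncomputable def ratioCoeff (n : ℕ) : ℝ := pathSum gaussWeight 0 (2 * n)

lemma ratioCoeff_nonneg (n : ℕ) : 0 ≤ ratioCoeff n := pathSum_nonneg _ gaussWeight_pos _ _

lemma mk_ratioCoeff_mul :
    PowerSeries.mk ratioCoeff * PowerSeries.mk (hyperCoeff 0) = PowerSeries.mk (hyperCoeff 1) := by
  have h := pathSum_mul_hyperCoeff 0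
  simp only [zero_add] at h
  exact h

lemma ratioCoeff_le_one (n : ℕ) : ratioCoeff n ≤ 1 := by
  refine le_trans ?_ (hyperCoeff_le_one le_rfl n)
  have h := congrArg (PowerSeries.coeff n) mk_ratioCoeff_mul
  rw [PowerSeries.coeff_mul, PowerSeries.coeff_mk] at h
  rw [← h]
  have := Finset.single_le_sum (s := Finset.HasAntidiagonal.antidiagonal n)
    (f := fun p => PowerSeries.coeff p.1 (PowerSeries.mk ratioCoeff) *
      PowerSeries.coeff p.2 (PowerSeries.mk (hyperCoeff 0)))
    (fun p _ => by
      simpa using mul_nonneg (ratioCoeff_nonneg p.1) (hyperCoeff_pos 0 p.2).le)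
    (show (n, 0) ∈ _ by simp)
  simpa [hyperCoeff] using this

lemma summable_succ_mul_pow {f : ℕ → ℝ}
    (hf : ∀ z ∈ Set.Ioo (0 : ℝ) 1, Summable fun m => |f m| * z ^ m) {z : ℝ}
    (hz : z ∈ Set.Ioo (0 : ℝ) 1) : Summable fun m : ℕ => |(m + 1) * f (m + 1)| * z ^ m := by
  obtain ⟨w, hzw, hw1⟩ := exists_between hz.2
  have hw0 : 0 < w := hz.1.trans hzw
  have hlim : Filter.Tendsto (fun m : ℕ => ((m : ℝ) + 1) * (z / w) ^ m) Filter.atTop (nhds 0) := by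
    have hr : ‖z / w‖ < 1 := by
      rw [Real.norm_of_nonneg (div_pos hz.1 hw0).le]; exact (div_lt_one hw0).2 hzw
    have h1 := (summable_pow_mul_geometric_of_norm_lt_one 1 hr).tendsto_atTop_zero
    have h2 := (summable_pow_mul_geometric_of_norm_lt_one 0 hr).tendsto_atTop_zero
    simpa [add_mul] using h1.add h2
  have hs : Summable fun m => |f (m + 1)| * w ^ m := by
    have := ((summable_nat_add_iff 1).2 (hf w ⟨hw0, hw1⟩)).mul_right w⁻¹
    refine this.congr fun m => ?_
    rw [pow_succ]
    field_simp
  refine summable_of_isBigO_nat hs (Asymptotics.IsBigO.of_bound 1 ?_)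
  filter_upwards [hlim.eventually (gt_mem_nhds one_pos)] with m hm
  have : ((m : ℝ) + 1) * z ^ m ≤ w ^ m := by
    rw [div_pow, mul_div_assoc', div_lt_one (by positivity)] at hm
    exact hm.le
  have hzm : 0 ≤ z ^ m := pow_nonneg hz.1.le m
  rw [Real.norm_of_nonneg (by positivity), Real.norm_of_nonneg (by positivity), one_mul, abs_mul,
    abs_of_nonneg (by positivity : (0 : ℝ) ≤ m + 1)]
  nlinarith [mul_le_mul_of_nonneg_left this (abs_nonneg (f (m + 1)))]

lemma hasDerivAt_tsum_mul_pow {f : ℕ → ℝ}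
    (hf : ∀ z ∈ Set.Ioo (0 : ℝ) 1, Summable fun m => |f m| * z ^ m) {z : ℝ}
    (hz : z ∈ Set.Ioo (0 : ℝ) 1) :
    HasDerivAt (fun z => ∑' m, f m * z ^ m) (∑' m : ℕ, ((m + 1) * f (m + 1)) * z ^ m) z := by
  obtain ⟨w, hzw, hw1⟩ := exists_between hz.2
  have hw0 : 0 < w := hz.1.trans hzw
  have hu : Summable fun m : ℕ => |(m : ℝ) * f m| * w ^ (m - 1) :=
    (summable_nat_add_iff 1).1 (by simpa using summable_succ_mul_pow hf ⟨hw0, hw1⟩)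
  have hle : ∀ (n : ℕ) (y : ℝ), y ∈ Set.Ioo 0 w →
      ‖f n * (n * y ^ (n - 1))‖ ≤ |(n : ℝ) * f n| * w ^ (n - 1) := fun n y hy => by
    rw [show f n * (n * y ^ (n - 1)) = n * f n * y ^ (n - 1) by ring, norm_mul, Real.norm_eq_abs,
      norm_pow, Real.norm_of_nonneg hy.1.le]
    gcongr
    exacts [hy.1.le, hy.2.le]
  have h := hasDerivAt_tsum_of_isPreconnected hu isOpen_Ioo isPreconnected_Ioo
    (g := fun m z => f m * z ^ m) (g' := fun m z => f m * (m * z ^ (m - 1)))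
    (fun n y _ => (hasDerivAt_pow n y).const_mul (f n)) hle (y₀ := z) ⟨hz.1, hzw⟩
    (Summable.of_norm (by
      refine (hf z hz).congr fun m => ?_
      rw [norm_mul, norm_pow, Real.norm_of_nonneg hz.1.le, Real.norm_eq_abs])) ⟨hz.1, hzw⟩
  convert! h using 1
  rw [Summable.tsum_eq_zero_add (Summable.of_norm_bounded hu fun n => hle n z ⟨hz.1, hzw⟩)]
  simp only [Nat.cast_zero, zero_mul, mul_zero, zero_add, Nat.cast_add, Nat.cast_one,
    Nat.add_sub_cancel]
  exact tsum_congr fun m => by ring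

/-- A power series whose coefficients are nonnegative from index `d` on, the `d`-th one being
positive, has at most `d` zeros in `(0, 1)`. -/
lemma card_zeros_tsum_le (d : ℕ) {f : ℕ → ℝ}
    (hf : ∀ z ∈ Set.Ioo (0 : ℝ) 1, Summable fun m => |f m| * z ^ m)
    (hnonneg : ∀ m, d ≤ m → 0 ≤ f m) (hpos : 0 < f d) (T : Finset ℝ)
    (hT : ∀ z ∈ T, z ∈ Set.Ioo (0 : ℝ) 1 ∧ ∑' m, f m * z ^ m = 0) : T.card ≤ d := by
  classical
  induction d generalizing f T with
  | zero =>
    rw [Nat.le_zero, Finset.card_eq_zero, Finset.eq_empty_iff_forall_notMem]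
    intro z hzT
    obtain ⟨hz, h0⟩ := hT z hzT
    have hs : Summable fun m => f m * z ^ m :=
      (hf z hz).congr fun m => by rw [abs_of_nonneg (hnonneg m m.zero_le)]
    exact (hs.tsum_pos (fun m => mul_nonneg (hnonneg m m.zero_le) (pow_nonneg hz.1.le m)) 0
      (by simpa using hpos)).ne' h0
  | succ d ih =>
    have hex : ∀ xy : ℝ × ℝ, ∃ c : ℝ, xy.1 ∈ T → xy.2 ∈ T → xy.1 < xy.2 →
        c ∈ Set.Ioo xy.1 xy.2 ∧ ∑' m : ℕ, ((m + 1) * f (m + 1)) * c ^ m = 0 := by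
      rintro ⟨x, y⟩
      by_cases h : x ∈ T ∧ y ∈ T ∧ x < y
      · obtain ⟨hx, hy, hxy⟩ := h
        have hsub : ∀ t ∈ Set.Icc x y, t ∈ Set.Ioo (0 : ℝ) 1 := fun t ht =>
          ⟨(hT x hx).1.1.trans_le ht.1, ht.2.trans_lt (hT y hy).1.2⟩
        obtain ⟨c, hc, h0⟩ := exists_hasDerivAt_eq_zero hxy
          (fun t ht => (hasDerivAt_tsum_mul_pow hf (hsub t ht)).continuousAt.continuousWithinAt)
          ((hT x hx).2.trans (hT y hy).2.symm)
          (fun t ht => hasDerivAt_tsum_mul_pow hf (hsub t (Set.Ioo_subset_Icc_self ht)))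
        exact ⟨c, fun _ _ _ => ⟨hc, h0⟩⟩
      · exact ⟨0, fun hx hy hxy => absurd ⟨hx, hy, hxy⟩ h⟩
    choose c hc using hex
    set S := ((T ×ˢ T).filter fun xy => xy.1 < xy.2).image c with hS
    have hcard : T.card ≤ S.card + 1 :=
      Finset.card_le_of_interleaved fun x hx y hy hxy _ =>
        ⟨c (x, y), Finset.mem_image_of_mem c (by simp [hx, hy, hxy]),
          (hc (x, y) hx hy hxy).1.1, (hc (x, y) hx hy hxy).1.2⟩
    have := ih (f := fun m => (m + 1) * f (m + 1)) (fun z hz => summable_succ_mul_pow hf hz)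
      (fun m hm => mul_nonneg (by positivity) (hnonneg _ (by omega)))
      (mul_pos (by positivity) hpos) S (by
        intro z hz
        obtain ⟨⟨x, y⟩, hxy, rfl⟩ := Finset.mem_image.1 hz
        simp only [Finset.mem_filter, Finset.mem_product] at hxy
        obtain ⟨h1, h2⟩ := hc (x, y) hxy.1.1 hxy.1.2 hxy.2
        exact ⟨⟨(hT x hxy.1.1).1.1.trans h1.1, h1.2.trans (hT y hxy.1.2).1.2⟩, h2⟩)
    omega

/-- Coefficients of `(1 + x) ^ (-1/2)`. -/
noncomputable def invSqrtCoeff : ℕ → ℝ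
  | 0 => 1
  | n + 1 => -(invSqrtCoeff n * ((2 * n + 1) / (2 * n + 2)))

lemma abs_invSqrtCoeff_le_one (n : ℕ) : |invSqrtCoeff n| ≤ 1 := by
  induction n with
  | zero => simp [invSqrtCoeff]
  | succ n ih =>
    rw [invSqrtCoeff, abs_neg, abs_mul]
    refine mul_le_one₀ ih (abs_nonneg _) ?_
    rw [abs_of_nonneg (by positivity), div_le_one (by positivity)]
    linarith

lemma ring_choose_eq_invSqrtCoeff (n : ℕ) : Ring.choose (-1 / 2 : ℝ) n = invSqrtCoeff n := by
  induction n with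
  | zero => simp [invSqrtCoeff]
  | succ n ih =>
    have h := Ring.choose_smul_choose (-1 / 2 : ℝ) (Nat.le_succ n)
    simp only [Nat.succ_eq_add_one, Nat.add_sub_cancel_left, Nat.choose_succ_self_right,
      Ring.choose_one_right, nsmul_eq_mul, ih] at h
    rw [invSqrtCoeff]
    push_cast at h
    field_simp
    linarith

lemma hasSum_invSqrtCoeff {x : ℝ} (hx : |x| < 1) :
    HasSum (fun n => invSqrtCoeff n * x ^ n) ((√(1 + x))⁻¹) := by
  have h := (one_add_rpow_hasFPowerSeriesOnBall_zero (a := (-1 / 2 : ℝ))).hasSum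
    (y := x) (by simpa [enorm_eq_nnnorm, ← NNReal.coe_lt_coe] using hx)
  have hx' := (abs_lt.1 hx).1
  simp only [zero_add, binomialSeries_apply, List.ofFn_const, List.prod_replicate, smul_eq_mul,
    ring_choose_eq_invSqrtCoeff] at h
  rwa [show (-1 / 2 : ℝ) = -(1 / 2) by ring, Real.rpow_neg (by linarith), ← Real.sqrt_eq_rpow] at h

/-- The moments of the semicircle law, up to normalization. -/
noncomputable def semicircleMoment (n : ℕ) : ℝ := ∫ θ in (0 : ℝ)..π, cos θ ^ n * sin θ ^ 2

lemma semicircleMoment_eq (n : ℕ) :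
    semicircleMoment n = (∫ θ in (0 : ℝ)..π, cos θ ^ n) / (n + 2) := by
  have h : semicircleMoment n = (∫ θ in (0 : ℝ)..π, cos θ ^ n) - ∫ θ in (0 : ℝ)..π, cos θ ^ (n + 2) := by
    rw [semicircleMoment, ← integral_sub]
    · exact integral_congr fun θ _ => by simp only [sin_sq]; ring
    all_goals exact Continuous.intervalIntegrable (by fun_prop) _ _
  rw [h, integral_cos_pow]
  simp only [sin_pi, sin_zero]
  field_simp
  ring

lemma semicircleMoment_add_two (n : ℕ) :
    semicircleMoment (n + 2) = semicircleMoment n * ((n + 1) / (n + 4)) := by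
  rw [semicircleMoment_eq, semicircleMoment_eq, integral_cos_pow]
  simp only [sin_pi, sin_zero]
  push_cast
  field_simp
  ring

lemma semicircleMoment_odd (m : ℕ) : semicircleMoment (2 * m + 1) = 0 := by
  induction m with
  | zero => rw [semicircleMoment_eq]; simp
  | succ m ih => rw [show 2 * (m + 1) + 1 = 2 * m + 1 + 2 by ring, semicircleMoment_add_two, ih,
      zero_mul]

lemma invSqrtCoeff_mul_semicircleMoment (m : ℕ) :
    invSqrtCoeff (2 * m) * semicircleMoment (2 * m) = π / 2 * hyperCoeff 0 m := by
  induction m with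
  | zero => rw [semicircleMoment_eq]; simp [invSqrtCoeff, hyperCoeff]
  | succ m ih =>
    rw [show 2 * (m + 1) = 2 * m + 1 + 1 by ring, semicircleMoment_add_two, invSqrtCoeff,
      invSqrtCoeff, hyperCoeff, ← mul_assoc (π / 2), ← ih]
    push_cast
    field_simp
    ring

lemma invSqrtCoeff_mul_semicircleMoment_succ (m : ℕ) :
    invSqrtCoeff (2 * m + 1) * semicircleMoment (2 * m + 2) = -(π / 2 * (hyperCoeff 1 m / 8)) := by
  induction m with
  | zero => rw [semicircleMoment_eq]; simp [invSqrtCoeff, hyperCoeff]; ring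
  | succ m ih =>
    have h8 : π / 2 * (hyperCoeff 1 m / 8) =
        -(invSqrtCoeff (2 * m + 1) * semicircleMoment (2 * m + 2)) := by rw [ih, neg_neg]
    rw [show 2 * (m + 1) + 1 = 2 * m + 1 + 1 + 1 by ring, show 2 * (m + 1) + 2 = 2 * m + 2 + 2 by ring,
      semicircleMoment_add_two, invSqrtCoeff,
      invSqrtCoeff, hyperCoeff, mul_div_right_comm, ← mul_assoc (π / 2), h8]
    push_cast
    field_simp
    ring

lemma hasSum_semicircle_integral {s : ℝ} (hs : s ∈ Set.Ioo (0 : ℝ) 1) (j : ℕ) :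
    HasSum (fun n => s ^ n * (invSqrtCoeff n * semicircleMoment (n + j)))
      (∫ θ in (0 : ℝ)..π, cos θ ^ j * (√(1 + s * cos θ))⁻¹ * sin θ ^ 2) := by
  have h := hasSum_integral_of_dominated_convergence (a := 0) (b := π) (μ := MeasureTheory.volume)
    (F := fun n θ => s ^ n * invSqrtCoeff n * (cos θ ^ (n + j) * sin θ ^ 2))
    (f := fun θ => cos θ ^ j * (√(1 + s * cos θ))⁻¹ * sin θ ^ 2) (fun n _ => s ^ n)
    (fun n => Continuous.aestronglyMeasurable (by fun_prop))
    (fun n => Filter.Eventually.of_forall fun θ _ => by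
      rw [norm_mul, norm_mul, norm_mul, norm_pow, norm_pow, norm_pow, Real.norm_of_nonneg hs.1.le,
        Real.norm_eq_abs, Real.norm_eq_abs, Real.norm_eq_abs]
      have h1 := abs_invSqrtCoeff_le_one n
      have h2 : |cos θ| ^ (n + j) ≤ 1 := pow_le_one₀ (abs_nonneg _) (abs_cos_le_one θ)
      have h3 : |sin θ| ^ 2 ≤ 1 := pow_le_one₀ (abs_nonneg _) (abs_sin_le_one θ)
      have h4 : 0 ≤ s ^ n := pow_nonneg hs.1.le n
      have h5 := mul_le_one₀ h2 (by positivity) h3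
      rw [mul_assoc]
      exact mul_le_of_le_one_right h4 (mul_le_one₀ h1 (by positivity) h5))
    (Filter.Eventually.of_forall fun θ _ => summable_geometric_of_lt_one hs.1.le hs.2)
    intervalIntegrable_const
    (Filter.Eventually.of_forall fun θ _ => by
      have hlt : |s * cos θ| < 1 := by
        rw [abs_mul, abs_of_pos hs.1]
        nlinarith [abs_cos_le_one θ, hs.1, hs.2]
      have := (hasSum_invSqrtCoeff hlt).mul_left (cos θ ^ j * sin θ ^ 2)
      convert! this using 1
      · ext n; rw [mul_pow]; ring
      · ring)
  convert! h using 2 with n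
  rw [integral_const_mul, semicircleMoment, mul_assoc]

lemma Ibar_eq_integral (k : ℕ) {s : ℝ} (hs : s ∈ Set.Ioo (0 : ℝ) 1) :
    Ibar k (s ^ 2 - 1) =
      s ^ 2 / 2 * ∫ θ in (0 : ℝ)..π, √(1 + s * cos θ) ^ k * (√(1 + s * cos θ))⁻¹ * sin θ ^ 2 := by
  have hpos : ∀ θ, 0 < 1 + s * cos θ := fun θ => by
    nlinarith [neg_one_le_cos θ, hs.1, hs.2]
  have h := integral_comp_mul_deriv' (a := π) (b := 0) (f := fun θ => √(1 + s * cos θ))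
    (f' := fun θ => (s * -sin θ) / (2 * √(1 + s * cos θ)))
    (g := fun u => u ^ k * √(s ^ 2 - 1 + 2 * u ^ 2 - u ^ 4))
    (fun θ _ => (((hasDerivAt_cos θ).const_mul s).const_add 1).sqrt (hpos θ).ne')
    (Continuous.continuousOn (by
      refine Continuous.div (by fun_prop) (by fun_prop) fun θ => ?_
      have := sqrt_pos.2 (hpos θ)
      positivity))
    (Continuous.continuousOn (by fun_prop))
  rw [Ibar, show 1 + (s ^ 2 - 1) = s ^ 2 by ring, sqrt_sq hs.1.le]
  simp only [cos_pi, cos_zero, mul_one, mul_neg, ← sub_eq_add_neg] at h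
  rw [← h, integral_symm, ← integral_neg, ← integral_const_mul]
  refine integral_congr fun θ hθ => ?_
  rw [Set.uIcc_of_le pi_pos.le] at hθ
  have hsin : 0 ≤ sin θ := sin_nonneg_of_mem_Icc hθ
  have hsq : √(1 + s * cos θ) ^ 2 = 1 + s * cos θ := sq_sqrt (hpos θ).le
  have hin : s ^ 2 - 1 + 2 * √(1 + s * cos θ) ^ 2 - √(1 + s * cos θ) ^ 4 = (s * sin θ) ^ 2 := by
    rw [show √(1 + s * cos θ) ^ 4 = (√(1 + s * cos θ) ^ 2) ^ 2 by ring, hsq, mul_pow, sin_sq]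
    ring
  simp only [Function.comp_apply]
  rw [hin, sqrt_sq (mul_nonneg hs.1.le hsin)]
  have := sqrt_pos.2 (hpos θ)
  field_simp

lemma hasSum_Ibar_zero {s : ℝ} (hs : s ∈ Set.Ioo (0 : ℝ) 1) :
    HasSum (fun m => s ^ 2 / 2 * (π / 2) * (hyperCoeff 0 m * (s ^ 2) ^ m)) (Ibar 0 (s ^ 2 - 1)) := by
  have h := hasSum_semicircle_integral hs 0
  have hinj : Function.Injective fun m : ℕ => 2 * m := fun a b h => by simpa using h
  rw [← hinj.hasSum_iff] at h
  · rw [Ibar_eq_integral 0 hs]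
    convert! h.mul_left (s ^ 2 / 2) using 1
    · ext m
      simp only [Function.comp_apply, add_zero]
      rw [invSqrtCoeff_mul_semicircleMoment, pow_mul]
      ring
  · intro n hn
    obtain ⟨m, rfl | rfl⟩ := Nat.even_or_odd' n
    · exact absurd ⟨m, rfl⟩ hn
    · rw [add_zero, semicircleMoment_odd]; ring

lemma hasSum_Ibar_two_sub {s : ℝ} (hs : s ∈ Set.Ioo (0 : ℝ) 1) :
    HasSum (fun m => s ^ 2 / 2 * (π / 2) * (-(s ^ 2 / 8) * (hyperCoeff 1 m * (s ^ 2) ^ m)))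
      (Ibar 2 (s ^ 2 - 1) - Ibar 0 (s ^ 2 - 1)) := by
  have h := hasSum_semicircle_integral hs 1
  have hinj : Function.Injective fun m : ℕ => 2 * m + 1 := fun a b h => by simpa using h
  have hpos : ∀ θ, 0 < 1 + s * cos θ := fun θ => by
    nlinarith [neg_one_le_cos θ, hs.1, hs.2]
  have hcont : ∀ k : ℕ, Continuous fun θ => √(1 + s * cos θ) ^ k * (√(1 + s * cos θ))⁻¹ * sin θ ^ 2 :=
    fun k => (((by fun_prop : Continuous fun θ => √(1 + s * cos θ) ^ k)).mul
      (Continuous.inv₀ (by fun_prop) fun θ => (sqrt_pos.2 (hpos θ)).ne')).mul (by fun_prop)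
  rw [← hinj.hasSum_iff] at h
  · rw [Ibar_eq_integral 0 hs, Ibar_eq_integral 2 hs, ← mul_sub, ← integral_sub
      ((hcont 2).intervalIntegrable _ _) ((hcont 0).intervalIntegrable _ _)]
    convert! h.mul_left (s ^ 2 / 2 * s) using 1
    · ext m
      simp only [Function.comp_apply]
      rw [add_assoc, one_add_one_eq_two, invSqrtCoeff_mul_semicircleMoment_succ, pow_succ s (2 * m), pow_mul]
      ring
    · rw [mul_assoc, ← integral_const_mul s]
      congr 1
      refine integral_congr fun θ _ => ?_
      simp only [sq_sqrt (hpos θ).le]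
      ring
  · intro n hn
    obtain ⟨m, rfl | rfl⟩ := Nat.even_or_odd' n
    · rw [semicircleMoment_odd]; ring
    · exact absurd ⟨m, rfl⟩ hn

/-- `φ` converges absolutely at `z`, with sum `v`. -/
def HasPowerSum (φ : PowerSeries ℝ) (z v : ℝ) : Prop :=
  (Summable fun m => |PowerSeries.coeff m φ| * z ^ m) ∧
    HasSum (fun m => PowerSeries.coeff m φ * z ^ m) v

lemma HasPowerSum.mul {φ ψ : PowerSeries ℝ} {z v w : ℝ} (hz : 0 ≤ z) (hφ : HasPowerSum φ z v)
    (hψ : HasPowerSum ψ z w) : HasPowerSum (φ * ψ) z (v * w) := by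
  have hn : ∀ {χ : PowerSeries ℝ}, (Summable fun m => |PowerSeries.coeff m χ| * z ^ m) →
      Summable fun m => ‖PowerSeries.coeff m χ * z ^ m‖ := fun h => h.congr fun m => by
    rw [norm_mul, norm_pow, Real.norm_of_nonneg hz, Real.norm_eq_abs]
  have heq : ∀ m, PowerSeries.coeff m (φ * ψ) * z ^ m =
      ∑ kl ∈ Finset.HasAntidiagonal.antidiagonal m,
        PowerSeries.coeff kl.1 φ * z ^ kl.1 * (PowerSeries.coeff kl.2 ψ * z ^ kl.2) := fun m => by
    rw [PowerSeries.coeff_mul, Finset.sum_mul]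
    refine Finset.sum_congr rfl fun kl hkl => ?_
    rw [← Finset.HasAntidiagonal.mem_antidiagonal.1 hkl, pow_add]
    ring
  have hs := summable_norm_sum_mul_antidiagonal_of_summable_norm (hn hφ.1) (hn hψ.1)
  simp only [← heq] at hs
  refine ⟨hs.congr fun m => by
    rw [norm_mul, norm_pow, Real.norm_of_nonneg hz, Real.norm_eq_abs], ?_⟩
  have ht := tsum_mul_tsum_eq_tsum_sum_antidiagonal_of_summable_norm (hn hφ.1) (hn hψ.1)
  simp only [← heq, hφ.2.tsum_eq, hψ.2.tsum_eq] at ht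
  rw [ht]
  exact hs.of_norm.hasSum

lemma HasPowerSum.sub {φ ψ : PowerSeries ℝ} {z v w : ℝ} (hz : 0 ≤ z) (hφ : HasPowerSum φ z v)
    (hψ : HasPowerSum ψ z w) : HasPowerSum (φ - ψ) z (v - w) := by
  refine ⟨(hφ.1.add hψ.1).of_nonneg_of_le (fun m => by positivity) fun m => ?_, ?_⟩
  · rw [← add_mul, map_sub]
    gcongr
    exact abs_sub _ _
  · simpa only [map_sub, sub_mul] using hφ.2.sub hψ.2

lemma hasPowerSum_coe (p : Polynomial ℝ) (z : ℝ) :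
    HasPowerSum (p : PowerSeries ℝ) z (p.eval z) := by
  have h0 : ∀ m ∉ Finset.range (p.natDegree + 1), p.coeff m = 0 := fun m hm =>
    Polynomial.coeff_eq_zero_of_natDegree_lt (by simpa [Nat.lt_succ_iff] using hm)
  constructor
  · exact summable_of_ne_finset_zero (s := Finset.range (p.natDegree + 1)) fun m hm => by
      rw [Polynomial.coeff_coe, h0 m hm, abs_zero, zero_mul]
  · rw [Polynomial.eval_eq_sum_range]
    simpa using hasSum_sum_of_ne_finset_zero (s := Finset.range (p.natDegree + 1))
      (f := fun m => p.coeff m * z ^ m) fun m hm => by rw [h0 m hm, zero_mul]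

lemma hasPowerSum_mk {a : ℕ → ℝ} (h0 : ∀ m, 0 ≤ a m) (h1 : ∀ m, a m ≤ 1) {z : ℝ}
    (hz : z ∈ Set.Ioo (0 : ℝ) 1) : HasPowerSum (PowerSeries.mk a) z (∑' m, a m * z ^ m) := by
  have hs : Summable fun m => a m * z ^ m :=
    (summable_geometric_of_lt_one hz.1.le hz.2).of_nonneg_of_le
      (fun m => mul_nonneg (h0 m) (pow_nonneg hz.1.le m))
      fun m => mul_le_of_le_one_left (pow_nonneg hz.1.le m) (h1 m)
  refine ⟨hs.congr fun m => ?_, ?_⟩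
  · rw [PowerSeries.coeff_mk, abs_of_nonneg (h0 m)]
  · simpa only [PowerSeries.coeff_mk] using hs.hasSum

lemma hasPowerSum_hyperCoeff {i : ℕ} (hi : i ≤ 1) {z : ℝ} (hz : z ∈ Set.Ioo (0 : ℝ) 1) :
    HasPowerSum (PowerSeries.mk (hyperCoeff i)) z (∑' m, hyperCoeff i m * z ^ m) :=
  hasPowerSum_mk (fun m => (hyperCoeff_pos i m).le) (hyperCoeff_le_one hi) hz

lemma hasPowerSum_ratioCoeff {z : ℝ} (hz : z ∈ Set.Ioo (0 : ℝ) 1) :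
    HasPowerSum (PowerSeries.mk ratioCoeff) z (∑' m, ratioCoeff m * z ^ m) :=
  hasPowerSum_mk ratioCoeff_nonneg ratioCoeff_le_one hz

lemma tsum_ratioCoeff_mul {z : ℝ} (hz : z ∈ Set.Ioo (0 : ℝ) 1) :
    (∑' m, ratioCoeff m * z ^ m) * ∑' m, hyperCoeff 0 m * z ^ m = ∑' m, hyperCoeff 1 m * z ^ m := by
  have h := (hasPowerSum_ratioCoeff hz).mul hz.1.le (hasPowerSum_hyperCoeff zero_le_one hz)
  rw [mk_ratioCoeff_mul] at h
  exact h.2.unique (hasPowerSum_hyperCoeff le_rfl hz).2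

lemma Ibar_zero_pos {h : ℝ} (hh : h ∈ Set.Ioo (-1 : ℝ) 0) : 0 < Ibar 0 h := by
  have hs : √(1 + h) ∈ Set.Ioo (0 : ℝ) 1 :=
    ⟨sqrt_pos.2 (by linarith [hh.1]), (sqrt_lt' one_pos).2 (by linarith [hh.2])⟩
  have hsum := hasSum_Ibar_zero hs
  rw [sq_sqrt (by linarith [hh.1]), add_sub_cancel_left] at hsum
  have hz : 0 < 1 + h := by linarith [hh.1]
  rw [← hsum.tsum_eq]
  refine hsum.summable.tsum_pos (fun m => ?_) 0 ?_
  · have := hyperCoeff_pos 0 m; positivity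
  · have := hyperCoeff_pos 0 0; positivity

lemma Ibar_two_sub_Ibar_zero {h : ℝ} (hh : h ∈ Set.Ioo (-1 : ℝ) 0) :
    8 * (Ibar 2 h - Ibar 0 h) =
      -((1 + h) * (∑' m, ratioCoeff m * (1 + h) ^ m) * Ibar 0 h) := by
  have hz : 1 + h ∈ Set.Ioo (0 : ℝ) 1 := ⟨by linarith [hh.1], by linarith [hh.2]⟩
  have hs : √(1 + h) ∈ Set.Ioo (0 : ℝ) 1 := ⟨sqrt_pos.2 hz.1, (sqrt_lt' one_pos).2 (by simpa using hz.2)⟩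
  have h0 := hasSum_Ibar_zero hs
  have h2 := hasSum_Ibar_two_sub hs
  rw [sq_sqrt hz.1.le, add_sub_cancel_left] at h0 h2
  rw [← h2.tsum_eq, ← h0.tsum_eq, tsum_mul_left, tsum_mul_left, tsum_mul_left,
    ← tsum_ratioCoeff_mul hz]
  ring

lemma coeff_sq_mul_ratioCoeff_pos {P : Polynomial ℝ} (hP : P ≠ 0) {d : ℕ} (hd : P.natDegree ≤ d)
    (j : ℕ) :
    0 < PowerSeries.coeff (j + 2 * d)
      ((P : PowerSeries ℝ) * ((P : PowerSeries ℝ) * PowerSeries.mk ratioCoeff)) := by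
  have hPsum : (P : PowerSeries ℝ) =
      ∑ a ∈ Finset.range (d + 1), PowerSeries.C (P.coeff a) * PowerSeries.X ^ a := by
    conv_lhs => rw [P.as_sum_range_C_mul_X_pow' (Nat.lt_succ_of_le hd)]
    rw [← Polynomial.coeToPowerSeries.ringHom_apply, map_sum]
    simp
  have key : PowerSeries.coeff (j + 2 * d)
      ((P : PowerSeries ℝ) * ((P : PowerSeries ℝ) * PowerSeries.mk ratioCoeff)) =
      ∑ a ∈ Finset.range (d + 1), ∑ b ∈ Finset.range (d + 1), P.coeff a * P.coeff b *
        pathSum gaussWeight 0 ((j + 2 * (d - a)) + (j + 2 * (d - b))) := by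
    rw [hPsum, ← mul_assoc, Finset.sum_mul_sum, Finset.sum_mul, map_sum]
    refine Finset.sum_congr rfl fun a ha => ?_
    rw [Finset.sum_mul, map_sum]
    refine Finset.sum_congr rfl fun b hb => ?_
    simp only [Finset.mem_range] at ha hb
    rw [show PowerSeries.C (P.coeff a) * PowerSeries.X ^ a * (PowerSeries.C (P.coeff b) *
        PowerSeries.X ^ b) * PowerSeries.mk ratioCoeff = PowerSeries.C (P.coeff a * P.coeff b) *
        (PowerSeries.X ^ (a + b) * PowerSeries.mk ratioCoeff) by rw [map_mul, pow_add]; ring,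
      PowerSeries.coeff_C_mul, PowerSeries.coeff_X_pow_mul', if_pos (by omega),
      PowerSeries.coeff_mk, ratioCoeff]
    congr 2
    omega
  rw [key]
  refine pathSum_hankel_pos gaussWeight gaussWeight_pos (fun a => j + 2 * (d - a)) P.coeff
    (fun a ha b hb hab => by omega) (a₀ := P.natDegree) (Nat.lt_succ_of_le hd) ?_
  rwa [Polynomial.coeff_natDegree, Polynomial.leadingCoeff_ne_zero]

/-- Let `n ≥ 2` and let `p, q` be real polynomials of degree at most
`n−2`, not both identically zero. Then `g(h) = p(h) Ī₂(h) + q(h) Ī₀(h)` has at most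
`2n−3` zeros in `(−1,0)`. -/
theorem stmt19 (n : ℕ) (hn : 2 ≤ n) (p q : Polynomial ℝ)
    (hp : p.natDegree ≤ n - 2) (hq : q.natDegree ≤ n - 2)
    (hne : ¬ (p = 0 ∧ q = 0)) :
    ∀ T : Finset ℝ,
      (∀ h ∈ T, h ∈ Set.Ioo (-1 : ℝ) 0 ∧
        p.eval h * Ibar 2 h + q.eval h * Ibar 0 h = 0) →
      T.card ≤ 2 * n - 3 := by
  intro T hT
  obtain ⟨d, rfl⟩ : ∃ d, n = d + 2 := ⟨n - 2, by omega⟩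
  rw [Nat.add_sub_cancel] at hp hq
  rw [show 2 * (d + 2) - 3 = 2 * d + 1 by omega]
  by_cases hp0 : p = 0
  · have hq0 : q ≠ 0 := fun h => hne ⟨hp0, h⟩
    have hroots : T.val ⊆ q.roots := fun h hh => by
      obtain ⟨hI, h0⟩ := hT h hh
      rw [hp0, Polynomial.eval_zero, zero_mul, zero_add] at h0
      exact (Polynomial.mem_roots hq0).2
        ((mul_eq_zero.1 h0).resolve_right (Ibar_zero_pos hI).ne')
    have := Polynomial.card_le_degree_of_subset_roots hroots
    omega
  set P := p.comp (Polynomial.X - Polynomial.C 1) with hPdef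
  set Q := (p + q).comp (Polynomial.X - Polynomial.C 1) with hQdef
  have hPdeg : P.natDegree ≤ d := by
    rw [hPdef, Polynomial.natDegree_comp, Polynomial.natDegree_X_sub_C, mul_one]; exact hp
  have hQdeg : Q.natDegree ≤ d := by
    rw [hQdef, Polynomial.natDegree_comp, Polynomial.natDegree_X_sub_C, mul_one]
    exact Polynomial.natDegree_add_le_of_degree_le hp hq
  have hP0 : P ≠ 0 := by
    rw [hPdef, Ne, Polynomial.comp_eq_zero_iff]
    rintro (h | ⟨-, h⟩)
    · exact hp0 h
    · have := congrArg Polynomial.natDegree h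
      rw [Polynomial.natDegree_X_sub_C, Polynomial.natDegree_C] at this
      exact one_ne_zero this
  set φ : PowerSeries ℝ := ((Polynomial.X : Polynomial ℝ) : PowerSeries ℝ) *
    ((P : PowerSeries ℝ) * ((P : PowerSeries ℝ) * PowerSeries.mk ratioCoeff)) -
    ((Polynomial.C 8 * (P * Q) : Polynomial ℝ) : PowerSeries ℝ) with hφ
  have hsum : ∀ z ∈ Set.Ioo (0 : ℝ) 1, HasPowerSum φ z
      (z * (P.eval z * (P.eval z * ∑' m, ratioCoeff m * z ^ m)) - 8 * (P.eval z * Q.eval z)) := by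
    intro z hz
    have h := ((hasPowerSum_coe Polynomial.X z).mul hz.1.le ((hasPowerSum_coe P z).mul hz.1.le
      ((hasPowerSum_coe P z).mul hz.1.le (hasPowerSum_ratioCoeff hz)))).sub hz.1.le
      (hasPowerSum_coe (Polynomial.C 8 * (P * Q)) z)
    simpa [hφ] using h
  have hcoeff : ∀ j, 0 < PowerSeries.coeff (j + (2 * d + 1)) φ := fun j => by
    have hdeg : (Polynomial.C 8 * (P * Q)).natDegree < j + (2 * d + 1) :=
      (Polynomial.natDegree_C_mul_le _ _).trans_lt (Polynomial.natDegree_mul_le.trans_lt (by omega))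
    rw [hφ, map_sub, Polynomial.coeff_coe, Polynomial.coeff_eq_zero_of_natDegree_lt hdeg, sub_zero,
      Polynomial.coe_X, ← add_assoc, PowerSeries.coeff_succ_X_mul]
    exact coeff_sq_mul_ratioCoeff_pos hP0 hPdeg j
  rw [← Finset.card_map (addLeftEmbedding (1 : ℝ))]
  refine card_zeros_tsum_le (2 * d + 1) (f := fun m => PowerSeries.coeff m φ)
    (fun z hz => (hsum z hz).1) (fun m hm => ?_) (by simpa using hcoeff 0) _ fun z hz => ?_
  · obtain ⟨j, rfl⟩ := Nat.exists_eq_add_of_le' hm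
    exact (hcoeff j).le
  · obtain ⟨h, hh, rfl⟩ := Finset.mem_map.1 hz
    obtain ⟨hI, h0⟩ := hT h hh
    have hz' : 1 + h ∈ Set.Ioo (0 : ℝ) 1 := ⟨by linarith [hI.1], by linarith [hI.2]⟩
    refine ⟨hz', (hsum _ hz').2.tsum_eq.trans ?_⟩
    have hPe : P.eval (1 + h) = p.eval h := by simp [hPdef]
    have hQe : Q.eval (1 + h) = p.eval h + q.eval h := by simp [hQdef]
    rw [hPe, hQe]
    refine (mul_eq_zero.1 ?_).resolve_right (Ibar_zero_pos hI).ne'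
    linear_combination (-8 * p.eval h) * h0 + p.eval h ^ 2 * Ibar_two_sub_Ibar_zero hI
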